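/- Let a and b be the automorphisms of the binary rooted tree {0,1}^* defined recursively by a(0w) = 1·b(w), a(1w) = 0w, b(0w) = 0·a(w), b(1w) = 1w, and let G = ⟨a, b⟩ (the iterated monodromy group of z² − 1). Then G is torsion free: every element of G other than the identity has infinite order. -/

import Mathlib

mutual
  /-- `a(0w) = 1·b(w)`, `a(1w) = 0w` (`false = 0`, `true = 1`). -/
  def aFun : List Bool → List Bool
    | [] => []
    | false :: w => true :: bFun w
    | true :: w => false :: w
  /-- `b(0w) = 0·a(w)`, `b(1w) = 1w`. -/
  def bFun : List Bool → List Bool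
    | [] => []
    | false :: w => false :: aFun w
    | true :: w => true :: w
end

mutual
  /-- The inverse of `aFun`. -/
  def aInv : List Bool → List Bool
    | [] => []
    | true :: w => false :: bInv w
    | false :: w => true :: w
  /-- The inverse of `bFun`. -/
  def bInv : List Bool → List Bool
    | [] => []
    | false :: w => false :: aInv w
    | true :: w => true :: w
end

lemma left_inv_ab : ∀ w : List Bool, aInv (aFun w) = w ∧ bInv (bFun w) = w := by
  intro w
  induction w with
  | nil => exact ⟨rfl, rfl⟩
  | cons x t ih =>
    cases x
    · exact ⟨by simp [aFun, aInv, ih.2], by simp [bFun, bInv, ih.1]⟩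
    · exact ⟨by simp [aFun, aInv], by simp [bFun, bInv]⟩

lemma right_inv_ab : ∀ w : List Bool, aFun (aInv w) = w ∧ bFun (bInv w) = w := by
  intro w
  induction w with
  | nil => exact ⟨rfl, rfl⟩
  | cons x t ih =>
    cases x
    · exact ⟨by simp [aFun, aInv], by simp [bFun, bInv, ih.1]⟩
    · exact ⟨by simp [aFun, aInv, ih.2], by simp [bFun, bInv]⟩

/-- The automorphism `a` of the binary rooted tree. -/
def aPerm : Equiv.Perm (List Bool) :=
  ⟨aFun, aInv, fun w => (left_inv_ab w).1, fun w => (right_inv_ab w).1⟩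

/-- The automorphism `b` of the binary rooted tree. -/
def bPerm : Equiv.Perm (List Bool) :=
  ⟨bFun, bInv, fun w => (left_inv_ab w).2, fun w => (right_inv_ab w).2⟩

/-- `HasParity g p q` says that `g` is represented by a word in `a` and `b` whose exponent sums
in `a` and in `b` have the parities `p` and `q` (`true` meaning odd). -/
inductive HasParity : Equiv.Perm (List Bool) → Bool → Bool → Prop
  | one : HasParity 1 false false
  | a : HasParity aPerm true false
  | b : HasParity bPerm false true
  | mul {g h p q p' q'} : HasParity g p q → HasParity h p' q' →
      HasParity (g * h) (p ^^ p') (q ^^ q')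
  | inv {g p q} : HasParity g p q → HasParity g⁻¹ p q

lemma exists_hasParity_of_mem_closure {g : Equiv.Perm (List Bool)}
    (hg : g ∈ Subgroup.closure {aPerm, bPerm}) : ∃ p q, HasParity g p q := by
  induction hg using Subgroup.closure_induction with
  | mem x hx =>
    rcases hx with rfl | rfl
    · exact ⟨_, _, .a⟩
    · exact ⟨_, _, .b⟩
  | one => exact ⟨_, _, .one⟩
  | mul x y _ _ hx hy =>
    obtain ⟨_, _, hx⟩ := hx
    obtain ⟨_, _, hy⟩ := hy
    exact ⟨_, _, hx.mul hy⟩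
  | inv x _ hx =>
    obtain ⟨_, _, hx⟩ := hx
    exact ⟨_, _, hx.inv⟩

namespace HasParity

variable {g : Equiv.Perm (List Bool)} {p q : Bool}

lemma apply_nil (hg : HasParity g p q) : g [] = [] := by
  induction hg with
  | one | a | b => rfl
  | mul _ _ ihg ihh => simp [ihg, ihh]
  | inv _ ih => rw [Equiv.Perm.inv_eq_iff_eq, ih]

/-- The first-level sections of `g`: passing to them exchanges the roles of `a` and `b`. -/
lemma exists_sections (hg : HasParity g p q) :
    ∃ (s : Bool → Equiv.Perm (List Bool)) (p' q' : Bool → Bool),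
      (∀ c, HasParity (s c) (p' c) (q' c)) ∧ (p' false ^^ p' true) = q ∧
      (q' false ^^ q' true) = p ∧ ∀ c w, g (c :: w) = (c ^^ p) :: s c w := by
  induction hg with
  | one =>
    exact ⟨fun _ => 1, fun _ => false, fun _ => false, fun _ => .one, rfl, rfl, by simp⟩
  | a =>
    refine ⟨fun c => if c then 1 else bPerm, fun _ => false, fun c => !c, ?_, rfl, rfl, ?_⟩
    · rintro (_ | _)
      exacts [.b, .one]
    · rintro (_ | _) w <;> rfl
  | b =>
    refine ⟨fun c => if c then 1 else aPerm, fun c => !c, fun _ => false, ?_, rfl, rfl, ?_⟩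
    · rintro (_ | _)
      exacts [.a, .one]
    · rintro (_ | _) w <;> rfl
  | @mul _ _ _ _ r _ _ _ ihg ihh =>
    obtain ⟨s, p₁, q₁, hs, rfl, rfl, hg⟩ := ihg
    obtain ⟨t, p₂, q₂, ht, rfl, hr, hh⟩ := ihh
    refine ⟨fun c => s (c ^^ r) * t c, fun c => p₁ (c ^^ r) ^^ p₂ c,
      fun c => q₁ (c ^^ r) ^^ q₂ c, fun c => (hs _).mul (ht c), ?_, ?_, ?_⟩
    · cases r <;> simp only [Bool.xor_false, Bool.xor_true, Bool.not_false, Bool.not_true] <;>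
        simp only [Bool.xor_comm, Bool.xor_left_comm]
    · refine Eq.trans ?_ (congrArg _ hr)
      cases r <;> simp only [Bool.xor_false, Bool.xor_true, Bool.not_false, Bool.not_true] <;>
        simp only [Bool.xor_comm, Bool.xor_left_comm]
    · intro c w
      simp only [Equiv.Perm.mul_apply, hg, hh, Bool.xor_comm, Bool.xor_left_comm]
  | @inv _ r _ _ ih =>
    obtain ⟨s, p₁, q₁, hs, rfl, hr, hg⟩ := ih
    refine ⟨fun c => (s (c ^^ r))⁻¹, fun c => p₁ (c ^^ r), fun c => q₁ (c ^^ r),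
      fun c => (hs _).inv, ?_, ?_, ?_⟩
    · cases r <;> simp [Bool.xor_comm]
    · refine Eq.trans ?_ hr
      cases r <;> simp [Bool.xor_comm]
    · intro c w
      rw [Equiv.Perm.inv_eq_iff_eq]
      simp [hg]

end HasParity

lemma pow_apply_cons {g s : Equiv.Perm (List Bool)} {c : Bool}
    (hs : ∀ w, g (c :: w) = c :: s w) (n : ℕ) (w : List Bool) :
    (g ^ n) (c :: w) = c :: (s ^ n) w := by
  induction n generalizing w with
  | zero => rfl
  | succ n ih => simp [pow_succ, hs, ih]

lemma section_pow_eq_one {g s : Equiv.Perm (List Bool)} {c : Bool}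
    (hs : ∀ w, g (c :: w) = c :: s w) {n : ℕ} (hg : g ^ n = 1) : s ^ n = 1 := by
  ext1 w
  simpa [hg, eq_comm] using pow_apply_cons hs n w

namespace HasParity

/-- An element with odd exponent sum in `a` has infinite order: it swaps the two subtrees, and
some section of its square, on the first or the second level, is again of this kind. -/
lemma pow_ne_one {n : ℕ} (hn : 0 < n) {g : Equiv.Perm (List Bool)} {q : Bool}
    (hg : HasParity g true q) : g ^ n ≠ 1 := by
  induction n using Nat.strong_induction_on generalizing g q with
  | _ n ih =>
    intro hgn
    obtain ⟨s, p₁, q₁, hs, hp, hq, hgs⟩ := hg.exists_sections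
    have hsq (w) : (g ^ 2) (false :: w) = false :: (s true * s false) w := by
      simp [sq, hgs]
    have hpar : HasParity (s true * s false) q true := by
      have := (hs true).mul (hs false)
      rwa [Bool.xor_comm, hp, Bool.xor_comm, hq] at this
    obtain ⟨m, rfl | rfl⟩ := n.even_or_odd'
    · have hm : (s true * s false) ^ m = 1 := section_pow_eq_one hsq (by rw [← pow_mul, hgn])
      cases q with
      | true => exact ih m (by lia) (by lia) hpar hm
      | false =>
        obtain ⟨u, v, _, hu, hr, -, hgu⟩ := hpar.exists_sections
        obtain ⟨c, hc⟩ : ∃ c, v c = true := by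
          by_contra! h
          simp [h] at hr
        refine ih m (by lia) (by lia) (hc ▸ hu c) (section_pow_eq_one (c := c) ?_ hm)
        simpa using hgu c
    · have h := pow_apply_cons hsq m []
      rw [← pow_mul] at h
      have : (g ^ (2 * m + 1)) [false] = [false] := by rw [hgn]; rfl
      rw [pow_succ', Equiv.Perm.mul_apply, h, hgs] at this
      simp at this

lemma apply_eq_self_of_pow_eq_one {n : ℕ} (hn : 0 < n) {g : Equiv.Perm (List Bool)} {p q : Bool}
    (hg : HasParity g p q) (hgn : g ^ n = 1) (w : List Bool) : g w = w := by
  induction w generalizing g p q with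
  | nil => exact hg.apply_nil
  | cons c w ih =>
    cases p with
    | true => exact absurd hgn (pow_ne_one hn hg)
    | false =>
      obtain ⟨s, _, _, hs, -, -, hgs⟩ := hg.exists_sections
      simp only [Bool.xor_false] at hgs
      rw [hgs, ih (hs c) (section_pow_eq_one (hgs c) hgn)]

end HasParity

/-- The iterated monodromy group `G = ⟨a, b⟩` of `z² − 1` is torsion free:
every element of `G` other than the identity has infinite order. -/
theorem statement12 :
    ∀ g : (Subgroup.closure {aPerm, bPerm} : Subgroup (Equiv.Perm (List Bool))),
      g ≠ 1 → ¬ IsOfFinOrder g := by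
  rintro ⟨g, hg⟩ hne hfin
  obtain ⟨n, hn, hgn⟩ := isOfFinOrder_iff_pow_eq_one.mp hfin
  obtain ⟨p, q, hpar⟩ := exists_hasParity_of_mem_closure hg
  refine hne (Subtype.ext (Equiv.ext fun w => ?_))
  exact hpar.apply_eq_self_of_pow_eq_one hn (congrArg Subtype.val hgn) w
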